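/- Let 𝒫 be a finite polyhedral complex in ℝ^n whose union of all members equals ℝ^n. Then a polyhedron F belongs to 𝒫 if and only if F is a face of some full-dimensional polyhedron in 𝒫. -/

import Mathlib

open Finset MeasureTheory

noncomputable section

/-- The threshold activation function. -/
def thresh (t : ℝ) : ℝ := if 0 < t then 1 else 0

/-- `T` is an affine map from `ℝ^a` to `ℝ^b`. -/
def IsAffineMap {a b : ℕ} (T : (Fin a → ℝ) → (Fin b → ℝ)) : Prop :=
  ∃ (M : Fin b → Fin a → ℝ) (c : Fin b → ℝ),
    ∀ x j, T x j = (∑ i, M j i * x i) + c j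

/-- `Hidden n k s w g` : `g = σ ∘ T_k ∘ ⋯ ∘ σ ∘ T_1 : ℝ^n → ℝ^w` is the function computed
by `k` hidden threshold layers, where the last hidden layer has width `w` and the total
number of hidden neurons (the size) is `s`. -/
inductive Hidden (n : ℕ) : ℕ → ℕ → (w : ℕ) → ((Fin n → ℝ) → (Fin w → ℝ)) → Prop
  | single {w : ℕ} (T : (Fin n → ℝ) → (Fin w → ℝ)) (hT : IsAffineMap T) :
      Hidden n 1 w w (fun x j => thresh (T x j))
  | comp {k s w w' : ℕ} {g : (Fin n → ℝ) → (Fin w → ℝ)}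
      (T : (Fin w → ℝ) → (Fin w' → ℝ)) (hg : Hidden n k s w g) (hT : IsAffineMap T) :
      Hidden n (k + 1) (s + w') w' (fun x j => thresh (T (g x) j))

/-- `f : ℝ^n → ℝ` is computed by a linear threshold neural network with `k` hidden layers
and size (number of hidden neurons) `s`. -/
def LTComputes (n k s : ℕ) (f : (Fin n → ℝ) → ℝ) : Prop :=
  ∃ (w : ℕ) (g : (Fin n → ℝ) → (Fin w → ℝ)) (a : Fin w → ℝ) (c : ℝ),
    Hidden n k s w g ∧ ∀ x, f x = (∑ j, a j * g x j) + c

/-- A polyhedron in `ℝ^n`: the intersection of finitely many closed halfspaces. -/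
def IsPolyhedron {n : ℕ} (P : Set (Fin n → ℝ)) : Prop :=
  ∃ (m : ℕ) (a : Fin m → Fin n → ℝ) (b : Fin m → ℝ),
    P = {x | ∀ i, (∑ j, a i j * x j) ≤ b i}

/-- `F` is a face of the polyhedron `P`. -/
def IsFace {n : ℕ} (F P : Set (Fin n → ℝ)) : Prop :=
  ∃ (c : Fin n → ℝ) (d : ℝ),
    (∀ x ∈ P, (∑ j, c j * x j) ≤ d) ∧ F = {x ∈ P | (∑ j, c j * x j) = d}

/-- A (finite) polyhedral complex in `ℝ^n`. -/
def IsPolyhedralComplex {n : ℕ} (Pc : Finset (Set (Fin n → ℝ))) : Prop :=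
  (∀ P ∈ Pc, IsPolyhedron P) ∧
  (∀ P ∈ Pc, ∀ Q ∈ Pc, IsFace (P ∩ Q) P ∧ IsFace (P ∩ Q) Q) ∧
  (∀ P ∈ Pc, ∀ F, IsFace F P → F ∈ Pc)

/-- The union of the members of `Pc` is all of `ℝ^n`. -/
def Covers {n : ℕ} (Pc : Finset (Set (Fin n → ℝ))) : Prop :=
  ⋃₀ (Pc : Set (Set (Fin n → ℝ))) = Set.univ

/-- The dimension of a polyhedron: the dimension of its affine hull. -/
def polyDim {n : ℕ} (P : Set (Fin n → ℝ)) : ℕ :=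
  Module.finrank ℝ (affineSpan ℝ P).direction

/-- `Pc` is a polyhedral complex covering `ℝ^n` with which `f` is compatible as a piecewise
constant function: `f` is constant on the relative interior of each member of `Pc`. -/
def CompatiblePWC {n : ℕ} (f : (Fin n → ℝ) → ℝ) (Pc : Finset (Set (Fin n → ℝ))) : Prop :=
  IsPolyhedralComplex Pc ∧ Covers Pc ∧
    ∀ P ∈ Pc, ∃ c : ℝ, ∀ x ∈ intrinsicInterior ℝ P, f x = c

/-- `f : ℝ^n → ℝ` is piecewise constant. -/
def IsPWC {n : ℕ} (f : (Fin n → ℝ) → ℝ) : Prop := ∃ Pc, CompatiblePWC f Pc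

/-- The cardinality `|Pc*_f|` of a minimum-cardinality polyhedral complex compatible with `f`. -/
def minCardPWC {n : ℕ} (f : (Fin n → ℝ) → ℝ) : ℕ :=
  sInf {c : ℕ | ∃ Pc, CompatiblePWC f Pc ∧ Pc.card = c}

theorem IsPolyhedron.isClosed {n : ℕ} {P : Set (Fin n → ℝ)} (hP : IsPolyhedron P) :
    IsClosed P := by
  obtain ⟨m, a, b, rfl⟩ := hP
  rw [Set.ofPred_forall]
  exact isClosed_iInter fun i => isClosed_le (by fun_prop) continuous_const

theorem IsPolyhedron.convex {n : ℕ} {P : Set (Fin n → ℝ)} (hP : IsPolyhedron P) :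
    Convex ℝ P := by
  obtain ⟨m, a, b, rfl⟩ := hP
  rw [Set.ofPred_forall]
  refine convex_iInter fun i => convex_halfSpace_le ⟨fun x y => ?_, fun t x => ?_⟩ (b i)
  · simp [mul_add, Finset.sum_add_distrib]
  · simp [Finset.mul_sum, mul_left_comm]

theorem polyDim_eq_of_interior_nonempty {n : ℕ} {P : Set (Fin n → ℝ)}
    (hP : (interior P).Nonempty) : polyDim P = n := by
  have h : affineSpan ℝ P = ⊤ :=
    top_unique <| (isOpen_interior.affineSpan_eq_top hP).symm.le.trans
      (affineSpan_mono ℝ interior_subset)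
  rw [polyDim, h, AffineSubspace.direction_top]
  simp

/-- Finitely many closed sets that cover a Baire space still cover it after discarding those with
empty interior. -/
theorem exists_mem_interior_nonempty_of_sUnion_eq_univ {X : Type*} [TopologicalSpace X]
    [BaireSpace X] {S : Set (Set X)} (hS : S.Finite) (hc : ∀ P ∈ S, IsClosed P)
    (hU : ⋃₀ S = Set.univ) (x : X) : ∃ P ∈ S, (interior P).Nonempty ∧ x ∈ P := by
  set T : Set (Set X) := {P ∈ S | (interior P).Nonempty}
  set N : Set (Set X) := {P ∈ S | interior P = ∅}
  have hT : IsClosed (⋃₀ T) := by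
    rw [Set.sUnion_eq_biUnion]
    exact (hS.subset (Set.sep_subset _ _)).isClosed_biUnion fun P hP => hc P hP.1
  have hD : Dense (⋂ P ∈ N, Pᶜ) :=
    dense_biInter_of_isOpen (fun P hP => (hc P hP.1).isOpen_compl)
      (hS.subset (Set.sep_subset _ _)).countable
      fun P hP => interior_eq_empty_iff_dense_compl.mp hP.2
  have hsub : (⋂ P ∈ N, Pᶜ) ⊆ ⋃₀ T := by
    intro y hy
    obtain ⟨P, hPS, hyP⟩ := Set.mem_sUnion.mp (hU.symm ▸ Set.mem_univ y : y ∈ ⋃₀ S)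
    refine ⟨P, ⟨hPS, Set.nonempty_iff_ne_empty.mpr fun h => ?_⟩, hyP⟩
    exact Set.mem_iInter₂.mp hy P ⟨hPS, h⟩ hyP
  obtain ⟨P, hP, hxP⟩ := closure_minimal hsub hT (hD x)
  exact ⟨P, hP.1, hP.2, hxP⟩

/-- From a relative interior point `x` of a set, one can move slightly away from any point `y` of
the set without leaving it. -/
theorem exists_pos_lineMap_neg_mem_of_mem_intrinsicInterior {E : Type*} [NormedAddCommGroup E]
    [NormedSpace ℝ E] {s : Set E} {x y : E} (hx : x ∈ intrinsicInterior ℝ s) (hy : y ∈ s) :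
    ∃ t : ℝ, 0 < t ∧ AffineMap.lineMap x y (-t) ∈ s := by
  obtain ⟨z, hz, rfl⟩ := mem_intrinsicInterior.mp hx
  have hmem : ∀ t : ℝ, AffineMap.lineMap (z : E) y (-t) ∈ affineSpan ℝ s := fun t =>
    AffineMap.lineMap_mem _ z.2 (subset_affineSpan ℝ s hy)
  let f : ℝ → affineSpan ℝ s := fun t => ⟨AffineMap.lineMap (z : E) y (-t), hmem t⟩
  have hf : Continuous f := by
    refine Continuous.subtype_mk ?_ _
    simp only [AffineMap.lineMap_apply_module]
    fun_prop
  have h0 : f 0 = z := by simp [f]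
  have hnhds : f ⁻¹' (((↑) : affineSpan ℝ s → E) ⁻¹' s) ∈ nhds (0 : ℝ) :=
    hf.continuousAt.preimage_mem_nhds (by rw [h0]; exact mem_interior_iff_mem_nhds.mp hz)
  obtain ⟨ε, hε, hball⟩ := Metric.mem_nhds_iff.mp hnhds
  refine ⟨ε / 2, half_pos hε, hball ?_⟩
  rw [Metric.mem_ball, Real.dist_eq, sub_zero, abs_of_pos (half_pos hε)]
  exact half_lt_self hε

theorem IsFace.eq_of_mem_intrinsicInterior {n : ℕ} {F P : Set (Fin n → ℝ)} (h : IsFace F P)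
    {x : Fin n → ℝ} (hx : x ∈ intrinsicInterior ℝ P) (hxF : x ∈ F) : F = P := by
  obtain ⟨c, d, hle, rfl⟩ := h
  refine Set.Subset.antisymm (Set.sep_subset _ _) fun y hy => ⟨hy, le_antisymm (hle y hy) ?_⟩
  obtain ⟨t, ht, hmem⟩ := exists_pos_lineMap_neg_mem_of_mem_intrinsicInterior hx hy
  have hc : ∑ j, c j * AffineMap.lineMap x y (-t) j
      = (1 + t) * ∑ j, c j * x j - t * ∑ j, c j * y j := by
    rw [Finset.mul_sum, Finset.mul_sum, ← Finset.sum_sub_distrib]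
    refine Finset.sum_congr rfl fun j _ => ?_
    simp only [AffineMap.lineMap_apply_module, Pi.add_apply, Pi.smul_apply, smul_eq_mul]
    ring
  have hl := hle _ hmem
  rw [hc, hxF.2] at hl
  exact le_of_mul_le_mul_left (by linarith) ht

theorem isFace_empty {n : ℕ} (P : Set (Fin n → ℝ)) : IsFace ∅ P :=
  ⟨0, 1, by simp, by simp⟩

/-- in a finite polyhedral complex `Pc` covering `ℝ^n`, a polyhedron `F`
belongs to `Pc` iff it is a face of some full-dimensional member of `Pc`. -/
theorem stmt_15 (n : ℕ) (Pc : Finset (Set (Fin n → ℝ)))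
    (hPc : IsPolyhedralComplex Pc) (hcov : Covers Pc)
    (F : Set (Fin n → ℝ)) (hF : IsPolyhedron F) :
    F ∈ Pc ↔ ∃ P ∈ Pc, polyDim P = n ∧ IsFace F P := by
  refine ⟨fun hmem => ?_, fun ⟨P, hP, _, hFP⟩ => hPc.2.2 P hP F hFP⟩
  have hfull : ∀ x, ∃ P ∈ Pc, polyDim P = n ∧ x ∈ P := fun x => by
    obtain ⟨P, hP, hint, hx⟩ := exists_mem_interior_nonempty_of_sUnion_eq_univ
      Pc.finite_toSet (fun P hP => (hPc.1 P hP).isClosed) hcov x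
    exact ⟨P, hP, polyDim_eq_of_interior_nonempty hint, hx⟩
  obtain rfl | hne := F.eq_empty_or_nonempty
  · obtain ⟨P, hP, hdim, -⟩ := hfull 0
    exact ⟨P, hP, hdim, isFace_empty P⟩
  · obtain ⟨x, hx⟩ := hne.intrinsicInterior hF.convex
    obtain ⟨P, hP, hdim, hxP⟩ := hfull x
    obtain ⟨hFP, hFF⟩ := hPc.2.1 P hP F hmem
    have heq : P ∩ F = F :=
      hFF.eq_of_mem_intrinsicInterior hx ⟨hxP, intrinsicInterior_subset hx⟩
    exact ⟨P, hP, hdim, heq ▸ hFP⟩
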